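/- (Consensus part of Theorem 2.) Consider a connected weighted undirected graph on n ≥ 2 vertices with Laplacian L. Let βᵢ > 0, ξᵢ ∈ [0,1], σᵢ ∈ [0,1) with σ_max = maxᵢ σᵢ, and θᵢ > 0 with θᵢ > (1 − ξᵢ)/βᵢ for every i. Let x : [0,∞) → ℝⁿ and χ : [0,∞) → ℝⁿ be differentiable and x̂ : [0,∞) → ℝⁿ be such that for all t ≥ 0 and all i, with e(t) = x̂(t) − x(t) and q̂ᵢ(t) = −(1/2) Σⱼ Lᵢⱼ (x̂ⱼ(t) − x̂ᵢ(t))²: ẋ(t) = −L x̂(t); χ̇ᵢ(t) = −βᵢχᵢ(t) + ξᵢ((σᵢ/2) q̂ᵢ(t) − Lᵢᵢ eᵢ(t)²); χᵢ(0) > 0; and the dynamic triggering condition θᵢ(Lᵢᵢ eᵢ(t)² − (σᵢ/2) q̂ᵢ(t)) ≤ χᵢ(t) holds. Define k_d = minᵢ(βᵢ − (1 − ξᵢ)/θᵢ) > 0, k_x = max{2 + ‖L‖σ_max/minᵢ Lᵢᵢ, 2(1 − σ_max)‖L‖/(k_d minᵢ{θᵢLᵢᵢ})}, and k_F = min{ρ₂(L)(1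 − σ_max)/k_x, k_d/2}. Then, with V(t) = (1/2) Σᵢ (xᵢ(t) − x̄(0))² and F(t) = V(t) + Σᵢ χᵢ(t), one has V(t) < F(t) ≤ F(0) e^{−k_F t} for all t ≥ 0; in particular each xᵢ(t) converges exponentially to the initial average x̄(0) = (1/n) Σᵢ xᵢ(0). -/

import Mathlib

open Matrix BigOperators

section helpers

variable {n : ℕ} {A L : Matrix (Fin n) (Fin n) ℝ}

lemma aux_mulVec (hL : L = Matrix.diagonal (fun i => ∑ j, A i j) - A) (w : Fin n → ℝ) (i : Fin n) :
    L.mulVec w i = ∑ j, A i j * (w i - w j) := by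
  subst hL
  rw [Matrix.sub_mulVec, Pi.sub_apply, Matrix.mulVec_diagonal]
  simp only [Matrix.mulVec, dotProduct, mul_sub, Finset.sum_sub_distrib, Finset.sum_mul]

lemma aux_diag (hAdiag : ∀ i, A i i = 0)
    (hL : L = Matrix.diagonal (fun i => ∑ j, A i j) - A) (i : Fin n) :
    L i i = ∑ j, A i j := by
  subst hL
  simp [hAdiag]

lemma aux_q (hL : L = Matrix.diagonal (fun i => ∑ j, A i j) - A) (w : Fin n → ℝ) (i : Fin n) :
    -(1/2) * ∑ j, L i j * (w j - w i)^2 = (1/2) * ∑ j, A i j * (w i - w j)^2 := by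
  have h := aux_mulVec hL (fun j => (w j - w i)^2) i
  simp only [Matrix.mulVec, dotProduct] at h
  rw [h, Finset.mul_sum, Finset.mul_sum]
  refine Finset.sum_congr rfl fun j _ => ?_
  ring

lemma aux_symm_sum (hAsymm : A.IsSymm) (f : Fin n → Fin n → ℝ) :
    ∑ i, ∑ j, A i j * f i j = ∑ i, ∑ j, A i j * f j i := by
  rw [Finset.sum_comm]
  refine Finset.sum_congr rfl fun i _ => Finset.sum_congr rfl fun j _ => ?_
  rw [hAsymm.apply]

lemma aux_quad (hAsymm : A.IsSymm)
    (hL : L = Matrix.diagonal (fun i => ∑ j, A i j) - A) (w : Fin n → ℝ) :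
    ∑ i, w i * L.mulVec w i = (1/2) * ∑ i, ∑ j, A i j * (w i - w j)^2 := by
  have h1 : ∑ i, w i * L.mulVec w i = ∑ i, ∑ j, A i j * (w i * (w i - w j)) := by
    refine Finset.sum_congr rfl fun i _ => ?_
    rw [aux_mulVec hL, Finset.mul_sum]
    refine Finset.sum_congr rfl fun j _ => ?_
    ring
  have h2 := aux_symm_sum hAsymm (fun i j => w i * (w i - w j))
  have h3 : ∑ i, ∑ j, A i j * (w i - w j)^2 = ∑ i, ∑ j, A i j * (w i * (w i - w j))
      + ∑ i, ∑ j, A i j * (w j * (w j - w i)) := by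
    simp only [← Finset.sum_add_distrib]
    refine Finset.sum_congr rfl fun i _ => Finset.sum_congr rfl fun j _ => ?_
    ring
  rw [h3, ← h2, h1]; ring

lemma aux_one (hAsymm : A.IsSymm)
    (hL : L = Matrix.diagonal (fun i => ∑ j, A i j) - A) (w : Fin n → ℝ) :
    ∑ i, L.mulVec w i = 0 := by
  have h2 := aux_symm_sum hAsymm (fun i j => (w i - w j))
  have h3 : ∑ i, ∑ j, A i j * (w j - w i) = - ∑ i, ∑ j, A i j * (w i - w j) := by
    simp only [← Finset.sum_neg_distrib]
    refine Finset.sum_congr rfl fun i _ => Finset.sum_congr rfl fun j _ => ?_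
    ring
  simp only [aux_mulVec hL]
  linarith

lemma aux_cross (hAnonneg : ∀ i j, 0 ≤ A i j) (hAdiag : ∀ i, A i i = 0)
    (hL : L = Matrix.diagonal (fun i => ∑ j, A i j) - A) (e w : Fin n → ℝ) :
    ∑ i, e i * L.mulVec w i ≤
      ∑ i, (L i i * e i ^ 2 + (1/4) * ∑ j, A i j * (w i - w j)^2) := by
  refine Finset.sum_le_sum fun i _ => ?_
  rw [aux_mulVec hL, aux_diag hAdiag hL, Finset.mul_sum, Finset.mul_sum, Finset.sum_mul,
    ← Finset.sum_add_distrib]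
  refine Finset.sum_le_sum fun j _ => ?_
  nlinarith [mul_nonneg (hAnonneg i j) (sq_nonneg (e i - (w i - w j)/2))]

lemma aux_split (hAsymm : A.IsSymm) (hAnonneg : ∀ i j, 0 ≤ A i j)
    (hL : L = Matrix.diagonal (fun i => ∑ j, A i j) - A) (x y : Fin n → ℝ) :
    ∑ i, x i * L.mulVec x i ≤ 2 * ∑ i, y i * L.mulVec y i
      + 2 * ∑ i, (y i - x i) * L.mulVec (fun k => y k - x k) i := by
  rw [aux_quad hAsymm hL x, aux_quad hAsymm hL y, aux_quad hAsymm hL (fun k => y k - x k)]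
  simp only [Finset.mul_sum, ← Finset.sum_add_distrib]
  refine Finset.sum_le_sum fun i _ => Finset.sum_le_sum fun j _ => ?_
  nlinarith [mul_nonneg (hAnonneg i j) (sq_nonneg ((x i - x j) - 2 * (y i - y j)))]

lemma aux_norm (e : Fin n → ℝ) :
    ∑ i, e i * L.mulVec e i ≤ ‖(Matrix.toEuclideanCLM (𝕜 := ℝ) L :
      EuclideanSpace ℝ (Fin n) →L[ℝ] EuclideanSpace ℝ (Fin n))‖ * ∑ i, e i ^ 2 := by
  set T := (Matrix.toEuclideanCLM (𝕜 := ℝ) L :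
      EuclideanSpace ℝ (Fin n) →L[ℝ] EuclideanSpace ℝ (Fin n)) with hT
  set v : EuclideanSpace ℝ (Fin n) := WithLp.toLp 2 e with hv
  have h1 : inner ℝ v (T v) = ∑ i, e i * L.mulVec e i := by
    rw [PiLp.inner_apply]
    refine Finset.sum_congr rfl fun i _ => ?_
    rw [hT, hv, Matrix.toEuclideanCLM_toLp]
    simp [mul_comm]
  have h2 : ‖v‖ ^ 2 = ∑ i, e i ^ 2 := by
    rw [EuclideanSpace.real_norm_sq_eq]
  rw [← h1, ← h2]
  calc inner ℝ v (T v) ≤ ‖v‖ * ‖T v‖ := real_inner_le_norm _ _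
    _ ≤ ‖v‖ * (‖T‖ * ‖v‖) := by gcongr; exact T.le_opNorm v
    _ = _ := by ring

lemma aux_diag_pos (hn : 2 ≤ n) (hAsymm : A.IsSymm) (hAnonneg : ∀ i j, 0 ≤ A i j)
    (hAdiag : ∀ i, A i i = 0)
    (hconn : (SimpleGraph.fromRel (fun i j => 0 < A i j)).Connected)
    (hL : L = Matrix.diagonal (fun i => ∑ j, A i j) - A) (i : Fin n) : 0 < L i i := by
  rw [aux_diag hAdiag hL]
  haveI : Nontrivial (Fin n) := Fin.nontrivial_iff_two_le.mpr hn
  obtain ⟨j, hj⟩ := hconn.preconnected.exists_adj_of_nontrivial i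
  rw [SimpleGraph.fromRel_adj] at hj
  have : 0 < A i j := by
    rcases hj.2 with h | h
    · exact h
    · rwa [hAsymm.apply] at h
  exact Finset.sum_pos' (fun j _ => hAnonneg i j) ⟨j, Finset.mem_univ _, this⟩

lemma aux_kernel (hAsymm : A.IsSymm) (hAnonneg : ∀ i j, 0 ≤ A i j)
    (hconn : (SimpleGraph.fromRel (fun i j => 0 < A i j)).Connected)
    (w : Fin n → ℝ) (h0 : ∑ i, ∑ j, A i j * (w i - w j)^2 = 0) (a b : Fin n) : w a = w b := by
  have hnn : ∀ i j, 0 ≤ A i j * (w i - w j)^2 := fun i j =>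
    mul_nonneg (hAnonneg i j) (sq_nonneg _)
  have h1 : ∀ i j, A i j * (w i - w j)^2 = 0 := by
    intro i j
    have := (Finset.sum_eq_zero_iff_of_nonneg
      (fun i _ => Finset.sum_nonneg fun j _ => hnn i j)).1 h0 i (Finset.mem_univ _)
    exact (Finset.sum_eq_zero_iff_of_nonneg (fun j _ => hnn i j)).1 this j (Finset.mem_univ _)
  have h2 : ∀ i j, 0 < A i j → w i = w j := by
    intro i j hij
    have := h1 i j
    rcases mul_eq_zero.1 this with h | h
    · exact absurd h hij.ne'
    · exact sub_eq_zero.1 (pow_eq_zero_iff (two_ne_zero) |>.1 h)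
  obtain ⟨p⟩ := hconn.preconnected a b
  induction p with
  | nil => rfl
  | cons hadj _ ih =>
    rw [← ih]
    rw [SimpleGraph.fromRel_adj] at hadj
    rcases hadj.2 with h | h
    · exact h2 _ _ h
    · exact (h2 _ _ h).symm

lemma aux_spec (hAsymm : A.IsSymm) (hAnonneg : ∀ i j, 0 ≤ A i j)
    (hconn : (SimpleGraph.fromRel (fun i j => 0 < A i j)).Connected)
    (hL : L = Matrix.diagonal (fun i => ∑ j, A i j) - A)
    (ρ₂ : ℝ)
    (hρ₂ : IsLeast {μ : ℝ | 0 < μ ∧ ∃ v : Fin n → ℝ, v ≠ 0 ∧ L.mulVec v = μ • v} ρ₂)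
    (y : Fin n → ℝ) (hy : ∑ i, y i = 0) :
    ρ₂ * ∑ i, y i ^ 2 ≤ ∑ i, y i * L.mulVec y i := by
  have hLsymm : L.IsSymm := by
    rw [hL]; exact (Matrix.isSymm_diagonal _).sub hAsymm
  have hH : L.IsHermitian := by
    rw [Matrix.IsHermitian, Matrix.conjTranspose_eq_transpose_of_trivial]; exact hLsymm
  set u := hH.eigenvectorBasis with hu
  have hev : ∀ k, L.mulVec (u k).ofLp = hH.eigenvalues k • (u k).ofLp := fun k =>
    hH.mulVec_eigenvectorBasis k
  have hne : ∀ k, (u k).ofLp ≠ 0 := by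
    intro k h
    have h1 : u k = 0 := by
      ext i; exact congrFun h i
    have := u.orthonormal.ne_zero k
    exact this h1
  set v : EuclideanSpace ℝ (Fin n) := WithLp.toLp 2 y with hv
  set z : EuclideanSpace ℝ (Fin n) := WithLp.toLp 2 (L.mulVec y) with hz
  have e1 : ∑ i, y i ^ 2 = ∑ k, (inner ℝ v (u k)) * (inner ℝ (u k) v) := by
    rw [u.sum_inner_mul_inner, PiLp.inner_apply]
    refine Finset.sum_congr rfl fun i _ => ?_
    simp [hv, sq]
  have e2 : ∑ i, y i * L.mulVec y i = ∑ k, (inner ℝ v (u k)) * (inner ℝ (u k) z) := by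
    rw [u.sum_inner_mul_inner, PiLp.inner_apply]
    refine Finset.sum_congr rfl fun i _ => ?_
    simp [hv, hz, mul_comm]
  have e3 : ∀ k, inner ℝ (u k) z = hH.eigenvalues k * inner ℝ (u k) v := by
    intro k
    have a1 : inner ℝ (u k) z = (u k).ofLp ⬝ᵥ L.mulVec y := by
      rw [PiLp.inner_apply]; simp [hz, dotProduct, mul_comm]
    have a2 : inner ℝ (u k) v = (u k).ofLp ⬝ᵥ y := by
      rw [PiLp.inner_apply]; simp [hv, dotProduct, mul_comm]
    rw [a1, a2, Matrix.dotProduct_mulVec, ← Matrix.mulVec_transpose, hLsymm.eq, hev,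
      smul_dotProduct, smul_eq_mul]
  rw [e1, e2, Finset.mul_sum]
  refine Finset.sum_le_sum fun k _ => ?_
  rw [e3, real_inner_comm v (u k)]
  have hq := aux_quad hAsymm hL (u k).ofLp
  have hsum : ∑ i, (u k).ofLp i * L.mulVec (u k).ofLp i
      = hH.eigenvalues k * ∑ i, (u k).ofLp i ^ 2 := by
    rw [hev, Finset.mul_sum]
    refine Finset.sum_congr rfl fun i _ => ?_
    simp only [Pi.smul_apply, smul_eq_mul]; ring
  have hpos : 0 < ∑ i, (u k).ofLp i ^ 2 := by
    obtain ⟨i, hi⟩ := Function.ne_iff.1 (hne k)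
    exact Finset.sum_pos' (fun j _ => sq_nonneg _) ⟨i, Finset.mem_univ _, by
      have : (u k).ofLp i ≠ 0 := hi
      positivity⟩
  have hQnn : 0 ≤ ∑ i, ∑ j, A i j * ((u k).ofLp i - (u k).ofLp j)^2 :=
    Finset.sum_nonneg fun i _ => Finset.sum_nonneg fun j _ =>
      mul_nonneg (hAnonneg i j) (sq_nonneg _)
  have hlam : 0 ≤ hH.eigenvalues k := by
    by_contra hneg
    push Not at hneg
    nlinarith
  rcases hlam.eq_or_lt with h0 | h0
  · have hc := aux_kernel hAsymm hAnonneg hconn (u k).ofLp (by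
      rw [← h0] at hsum; linarith)
    have : inner ℝ v (u k) = 0 := by
      rw [PiLp.inner_apply]
      obtain ⟨a⟩ := hconn.nonempty
      have : ∀ i, inner ℝ (v i) ((u k) i) = (u k).ofLp a * y i := by
        intro i
        have := hc i a
        simp [hv, this]
      simp only [this]
      rw [← Finset.mul_sum, hy, mul_zero]
    simp [real_inner_comm, this]
  · have hle : ρ₂ ≤ hH.eigenvalues k := hρ₂.2 ⟨h0, _, hne k, hev k⟩
    nlinarith [mul_le_mul_of_nonneg_right hle (mul_self_nonneg (inner ℝ (u k) v))]

end helpers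

/-- differential inequality -/
lemma aux_gronwall (f f' : ℝ → ℝ) (c : ℝ) (hf : ∀ t, 0 ≤ t → HasDerivAt f (f' t) t)
    (h : ∀ t, 0 ≤ t → f' t ≤ -c * f t) (t : ℝ) (ht : 0 ≤ t) :
    f t ≤ f 0 * Real.exp (-c * t) := by
  have hd : ∀ t, 0 ≤ t → HasDerivAt (fun s => f s * Real.exp (c * s))
      (f' t * Real.exp (c * t) + f t * (Real.exp (c * t) * c)) t := by
    intro t ht
    have h1 : HasDerivAt (fun s : ℝ => c * s) c t := by
      simpa using (hasDerivAt_id t).const_mul c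
    exact (hf t ht).mul h1.exp
  have hanti : AntitoneOn (fun s => f s * Real.exp (c * s)) (Set.Ici 0) := by
    refine antitoneOn_of_deriv_nonpos (convex_Ici 0) ?_ ?_ ?_
    · exact fun s hs => (hd s hs).continuousAt.continuousWithinAt
    · intro s hs
      rw [interior_Ici] at hs
      exact (hd s (le_of_lt hs)).differentiableAt.differentiableWithinAt
    · intro s hs
      rw [interior_Ici] at hs
      rw [(hd s (le_of_lt hs)).deriv]
      have := h s (le_of_lt hs)
      nlinarith [Real.exp_pos (c * s)]
  have := hanti (Set.mem_Ici.2 le_rfl) (Set.mem_Ici.2 ht) ht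
  simp only [mul_zero, Real.exp_zero, mul_one] at this
  have h2 : f t = f t * Real.exp (c * t) * Real.exp (-c * t) := by
    rw [mul_assoc, ← Real.exp_add]; simp
  rw [h2]
  exact mul_le_mul_of_nonneg_right this (Real.exp_pos _).le

/-- consensus part of Theorem 2: under the dynamic triggering law
of the discontinuous approach, with `F(t) = V(t) + Σᵢ χᵢ(t)`,
`k_d = minᵢ(βᵢ − (1 − ξᵢ)/θᵢ)`, `k_x = max{2 + ‖L‖σ_max/minᵢ Lᵢᵢ,
2(1 − σ_max)‖L‖/(k_d minᵢ{θᵢLᵢᵢ})}` and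
`k_F = min{ρ₂(L)(1 − σ_max)/k_x, k_d/2}`, one has
`V(t) < F(t) ≤ F(0) e^{−k_F t}`. -/
theorem dynamic_trigger_discontinuous_exponential_consensus
    (n : ℕ) (hn : 2 ≤ n)
    (A : Matrix (Fin n) (Fin n) ℝ)
    (hAsymm : A.IsSymm)
    (hAnonneg : ∀ i j, 0 ≤ A i j)
    (hAdiag : ∀ i, A i i = 0)
    (hconn : (SimpleGraph.fromRel (fun i j => 0 < A i j)).Connected)
    (L : Matrix (Fin n) (Fin n) ℝ)
    (hL : L = Matrix.diagonal (fun i => ∑ j, A i j) - A)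
    (ρ₂ : ℝ)
    (hρ₂ : IsLeast {μ : ℝ | 0 < μ ∧ ∃ v : Fin n → ℝ, v ≠ 0 ∧ L.mulVec v = μ • v} ρ₂)
    (normL : ℝ)
    (hnormL : normL = ‖(Matrix.toEuclideanCLM (𝕜 := ℝ) L :
      EuclideanSpace ℝ (Fin n) →L[ℝ] EuclideanSpace ℝ (Fin n))‖)
    (m : ℝ) (hm : IsLeast (Set.range fun i => L i i) m)
    (β ξ σ θ : Fin n → ℝ)
    (hβ : ∀ i, 0 < β i)
    (hξ : ∀ i, ξ i ∈ Set.Icc (0 : ℝ) 1)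
    (hσ : ∀ i, σ i ∈ Set.Ico (0 : ℝ) 1)
    (hθ : ∀ i, 0 < θ i ∧ (1 - ξ i) / β i < θ i)
    (σmax : ℝ) (hσmax : IsGreatest (Set.range σ) σmax)
    (mθ : ℝ) (hmθ : IsLeast (Set.range fun i => θ i * L i i) mθ)
    (x xhat : ℝ → Fin n → ℝ) (χ : ℝ → Fin n → ℝ)
    (e : ℝ → Fin n → ℝ) (he : ∀ t i, e t i = xhat t i - x t i)
    (qhat : ℝ → Fin n → ℝ)
    (hqhat : ∀ t i, qhat t i = -(1/2) * ∑ j, L i j * (xhat t j - xhat t i)^2)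
    (hx : ∀ t : ℝ, 0 ≤ t → HasDerivAt x (-(L.mulVec (xhat t))) t)
    (hχderiv : ∀ t : ℝ, 0 ≤ t → ∀ i,
      HasDerivAt (fun τ => χ τ i)
        (-(β i) * χ t i + ξ i * (σ i / 2 * qhat t i - L i i * (e t i)^2)) t)
    (hχ0 : ∀ i, 0 < χ 0 i)
    (htrig : ∀ t : ℝ, 0 ≤ t → ∀ i,
      θ i * (L i i * (e t i)^2 - σ i / 2 * qhat t i) ≤ χ t i)
    (xbar : ℝ) (hxbar : xbar = (1 / (n : ℝ)) * ∑ i, x 0 i)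
    (V F : ℝ → ℝ)
    (hV : ∀ t, V t = (1/2) * ∑ i, (x t i - xbar)^2)
    (hF : ∀ t, F t = V t + ∑ i, χ t i)
    (kd : ℝ) (hkd : IsLeast (Set.range fun i => β i - (1 - ξ i) / θ i) kd)
    (kx : ℝ) (hkx : kx = max (2 + normL * σmax / m) (2 * (1 - σmax) * normL / (kd * mθ)))
    (kF : ℝ) (hkF : kF = min (ρ₂ * (1 - σmax) / kx) (kd / 2)) :
    0 < kd ∧
    ∀ t : ℝ, 0 ≤ t → V t < F t ∧ F t ≤ F 0 * Real.exp (-kF * t) := by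
  have hqA : ∀ t i, qhat t i = (1/2) * ∑ j, A i j * (xhat t i - xhat t j)^2 := fun t i => by
    rw [hqhat, aux_q hL]
  have hqnn : ∀ t i, 0 ≤ qhat t i := fun t i => by
    rw [hqA]
    exact mul_nonneg (by norm_num) (Finset.sum_nonneg fun j _ =>
      mul_nonneg (hAnonneg i j) (sq_nonneg _))
  have hLpos : ∀ i, 0 < L i i := aux_diag_pos hn hAsymm hAnonneg hAdiag hconn hL
  have hkdpos : 0 < kd := by
    obtain ⟨i, hi⟩ := hkd.1
    rw [← hi]
    have h1 := (hθ i).2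
    rw [div_lt_iff₀ (hβ i)] at h1
    have : (1 - ξ i) / θ i < β i := by
      rw [div_lt_iff₀ (hθ i).1]; linarith
    simpa using this
  have hmpos : 0 < m := by
    obtain ⟨i, hi⟩ := hm.1
    rw [← hi]; exact hLpos i
  have hmθpos : 0 < mθ := by
    obtain ⟨i, hi⟩ := hmθ.1
    rw [← hi]; exact mul_pos (hθ i).1 (hLpos i)
  have hσm : 0 ≤ σmax ∧ σmax < 1 := by
    obtain ⟨i, hi⟩ := hσmax.1
    rw [← hi]; exact hσ i
  have hσle : ∀ i, σ i ≤ σmax := fun i => hσmax.2 ⟨i, rfl⟩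
  have hNnn : 0 ≤ normL := by rw [hnormL]; exact norm_nonneg _
  have hρpos : 0 < ρ₂ := hρ₂.1.1
  have hkxA : 2 + normL * σmax / m ≤ kx := by rw [hkx]; exact le_max_left _ _
  have hkxB : 2 * (1 - σmax) * normL / (kd * mθ) ≤ kx := by rw [hkx]; exact le_max_right _ _
  have hkxpos : 0 < kx := by
    have : 0 ≤ normL * σmax / m := div_nonneg (mul_nonneg hNnn hσm.1) hmpos.le
    linarith
  have hnpos : (0 : ℝ) < n := by
    have : 0 < n := by omega
    exact_mod_cast this
  haveI : Nonempty (Fin n) := hconn.nonempty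
  -- positivity of χ
  have hχpos : ∀ t, 0 ≤ t → ∀ i, 0 < χ t i := by
    intro t ht i
    have hg := aux_gronwall (fun s => - χ s i)
      (fun s => -(-(β i) * χ s i + ξ i * (σ i / 2 * qhat s i - L i i * (e s i)^2)))
      (β i + ξ i / θ i) (fun s hs => (hχderiv s hs i).neg) (by
        intro s hs
        have h1 := htrig s hs i
        have h2 : L i i * (e s i)^2 - σ i / 2 * qhat s i ≤ χ s i / θ i := by
          rw [le_div_iff₀ (hθ i).1]; linarith
        have h3 := mul_le_mul_of_nonneg_left h2 (hξ i).1
        have h4 : ξ i * (χ s i / θ i) = ξ i / θ i * χ s i := by ring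
        rw [h4] at h3
        linarith) t ht
    have := mul_pos (hχ0 i) (Real.exp_pos (-(β i + ξ i / θ i) * t))
    linarith
  -- conservation of the average
  have hxi : ∀ t, 0 ≤ t → ∀ i, HasDerivAt (fun s => x s i) (-(L.mulVec (xhat t) i)) t := by
    intro t ht i
    have := (hasDerivAt_pi.1 (hx t ht)) i
    simpa using this
  have hS : ∀ t, 0 ≤ t → HasDerivAt (fun s => ∑ i, x s i) 0 t := by
    intro t ht
    have h1 := HasDerivAt.fun_sum (u := Finset.univ) (fun i _ => hxi t ht i)
    rwa [Finset.sum_neg_distrib, aux_one hAsymm hL, neg_zero] at h1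
  have hSc : ∀ t, 0 ≤ t → ∑ i, x t i = ∑ i, x 0 i := by
    intro t ht
    have h1 := aux_gronwall (fun s => ∑ i, x s i) (fun _ => 0) 0 hS (by simp) t ht
    have h2 := aux_gronwall (fun s => -∑ i, x s i) (fun _ => 0) 0
      (fun s hs => by
        have h3 := (hS s hs).neg
        rw [neg_zero] at h3
        exact h3) (by simp) t ht
    simp at h1 h2
    linarith
  have hzero : ∀ t, 0 ≤ t → ∑ i, (x t i - xbar) = 0 := by
    intro t ht
    rw [Finset.sum_sub_distrib, hSc t ht, hxbar]
    simp
    field_simp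
    simp
  have hVd : ∀ t, 0 ≤ t → HasDerivAt V (-∑ i, x t i * L.mulVec (xhat t) i) t := by
    intro t ht
    have h1 := (HasDerivAt.fun_sum (u := Finset.univ)
      (fun i _ => ((hxi t ht i).sub_const xbar).fun_pow 2)).const_mul (1/2 : ℝ)
    have h2 : V = fun s => (1/2) * ∑ i, (x s i - xbar)^2 := funext hV
    rw [h2]
    refine HasDerivAt.congr_deriv h1 ?_
    symm
    have h3 : ∑ i, xbar * L.mulVec (xhat t) i = 0 := by
      rw [← Finset.mul_sum, aux_one hAsymm hL, mul_zero]
    rw [← sub_zero (-∑ i, x t i * L.mulVec (xhat t) i), ← neg_zero, ← h3, Finset.mul_sum,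
      ← Finset.sum_neg_distrib, ← Finset.sum_neg_distrib, ← Finset.sum_sub_distrib]
    refine Finset.sum_congr rfl fun i _ => ?_
    push_cast
    ring
  have hFd : ∀ t, 0 ≤ t → HasDerivAt F (-∑ i, x t i * L.mulVec (xhat t) i +
      ∑ i, (-(β i) * χ t i + ξ i * (σ i / 2 * qhat t i - L i i * (e t i)^2))) t := by
    intro t ht
    have h2 : F = fun s => V s + ∑ i, χ s i := funext hF
    rw [h2]
    exact (hVd t ht).add (HasDerivAt.fun_sum (fun i _ => hχderiv t ht i))
  have hmain : ∀ t, 0 ≤ t → (-∑ i, x t i * L.mulVec (xhat t) i +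
      ∑ i, (-(β i) * χ t i + ξ i * (σ i / 2 * qhat t i - L i i * (e t i)^2))) ≤ -kF * F t := by
    intro t ht
    set Q := ∑ i, qhat t i with hQ
    set X := ∑ i, χ t i with hX
    have hQnn : 0 ≤ Q := Finset.sum_nonneg fun i _ => hqnn t i
    have hXnn : 0 ≤ X := Finset.sum_nonneg fun i _ => (hχpos t ht i).le
    have hQL : ∑ i, xhat t i * L.mulVec (xhat t) i = Q := by
      rw [aux_quad hAsymm hL, hQ, Finset.mul_sum]
      exact Finset.sum_congr rfl fun i _ => (hqA t i).symm
    have hxe : -∑ i, x t i * L.mulVec (xhat t) i =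
        -Q + ∑ i, e t i * L.mulVec (xhat t) i := by
      rw [← hQL, ← Finset.sum_neg_distrib, ← Finset.sum_neg_distrib, ← Finset.sum_add_distrib]
      refine Finset.sum_congr rfl fun i _ => ?_
      rw [he]; ring
    have hcr := aux_cross hAnonneg hAdiag hL (e t) (xhat t)
    -- first bound
    have hB1 : (-∑ i, x t i * L.mulVec (xhat t) i +
      ∑ i, (-(β i) * χ t i + ξ i * (σ i / 2 * qhat t i - L i i * (e t i)^2))) ≤
        -((1 - σmax) / 2) * Q - kd * X := by
      rw [hxe]
      refine (add_le_add_left (add_le_add_right hcr _) _).trans ?_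
      rw [hQ, hX, ← Finset.sum_neg_distrib, Finset.mul_sum, Finset.mul_sum,
        ← Finset.sum_add_distrib, ← Finset.sum_add_distrib, ← Finset.sum_sub_distrib]
      refine Finset.sum_le_sum fun i _ => ?_
      have hq4 : (1/4 : ℝ) * ∑ j, A i j * (xhat t i - xhat t j)^2 = (1/2) * qhat t i := by
        rw [hqA]; ring
      rw [hq4]
      have h1 := htrig t ht i
      have h2 : L i i * (e t i)^2 - σ i / 2 * qhat t i ≤ χ t i / θ i := by
        rw [le_div_iff₀ (hθ i).1]; linarith
      have h3 := mul_le_mul_of_nonneg_left h2 (sub_nonneg.2 (hξ i).2)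
      have h4 : (1 - ξ i) * (χ t i / θ i) = (1 - ξ i) / θ i * χ t i := by ring
      rw [h4] at h3
      have h5 : kd ≤ β i - (1 - ξ i) / θ i := hkd.2 ⟨i, rfl⟩
      have h6 := mul_le_mul_of_nonneg_right h5 (hχpos t ht i).le
      have h7 := mul_le_mul_of_nonneg_right (hσle i) (hqnn t i)
      linarith
    -- bound on e
    have hE : ∑ i, e t i ^ 2 ≤ σmax / (2 * m) * Q + X / mθ := by
      rw [hQ, hX, Finset.mul_sum, Finset.sum_div, ← Finset.sum_add_distrib]
      refine Finset.sum_le_sum fun i _ => ?_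
      have h1 := htrig t ht i
      have hmi : m ≤ L i i := hm.2 ⟨i, rfl⟩
      have hmθi : mθ ≤ θ i * L i i := hmθ.2 ⟨i, rfl⟩
      have hθL : 0 < θ i * L i i := mul_pos (hθ i).1 (hLpos i)
      have h2 : e t i ^ 2 ≤ σ i / (2 * L i i) * qhat t i + χ t i / (θ i * L i i) := by
        have h3 : σ i / (2 * L i i) * qhat t i + χ t i / (θ i * L i i) =
          (θ i * (σ i / 2 * qhat t i) + χ t i) / (θ i * L i i) := by
          have := (hLpos i).ne'
          have := (hθ i).1.ne'
          field_simp
        rw [h3, le_div_iff₀ hθL]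
        linarith
      refine h2.trans (add_le_add ?_ ?_)
      · refine mul_le_mul_of_nonneg_right ?_ (hqnn t i)
        exact div_le_div₀ hσm.1 (hσle i) (by linarith) (by linarith)
      · exact div_le_div_of_nonneg_left (hχpos t ht i).le hmθpos hmθi
    -- bound on xᵀ L x
    have hsp := aux_split hAsymm hAnonneg hL (x t) (xhat t)
    have hfe : (fun k => xhat t k - x t k) = e t := funext fun k => (he t k).symm
    have hnm := aux_norm (L := L) (e t)
    rw [← hnormL] at hnm
    have hxx : ∑ i, (xhat t i - x t i) * L.mulVec (fun k => xhat t k - x t k) i =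
        ∑ i, e t i * L.mulVec (e t) i := by
      rw [hfe]; exact Finset.sum_congr rfl fun i _ => by rw [he]
    rw [hxx, hQL] at hsp
    have hNE := mul_le_mul_of_nonneg_left hE hNnn
    have hxLx : ∑ i, x t i * L.mulVec (x t) i ≤ kx * Q + 2 * normL / mθ * X := by
      have h1 := mul_le_mul_of_nonneg_right hkxA hQnn
      have h2 : 2 * (normL * (σmax / (2 * m) * Q + X / mθ)) =
          normL * σmax / m * Q + 2 * normL / mθ * X := by
        field_simp
      linarith
    -- spectral bound
    have hspec := aux_spec hAsymm hAnonneg hconn hL ρ₂ hρ₂ (fun i => x t i - xbar) (hzero t ht)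
    have hshift : ∑ i, (x t i - xbar) * L.mulVec (fun i => x t i - xbar) i =
        ∑ i, x t i * L.mulVec (x t) i := by
      rw [aux_quad hAsymm hL (fun i => x t i - xbar), aux_quad hAsymm hL (x t)]
      simp
    rw [hshift] at hspec
    have hV2 : ∑ i, (x t i - xbar)^2 = 2 * V t := by rw [hV]; ring
    rw [hV2] at hspec
    have hVnn : 0 ≤ V t := by
      rw [hV]; positivity
    have hk1 : kF ≤ ρ₂ * (1 - σmax) / kx := by rw [hkF]; exact min_le_left _ _
    have hk2 : kF ≤ kd / 2 := by rw [hkF]; exact min_le_right _ _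
    have h10 : ρ₂ * (2 * V t) ≤ kx * Q + 2 * normL / mθ * X := hspec.trans hxLx
    have hs1 : 0 ≤ 1 - σmax := by linarith [hσm.2]
    have h11 : (1 - σmax) / (2 * kx) * (ρ₂ * (2 * V t)) ≤
        (1 - σmax) / (2 * kx) * (kx * Q + 2 * normL / mθ * X) :=
      mul_le_mul_of_nonneg_left h10 (div_nonneg hs1 (by linarith))
    have h12 : (1 - σmax) / (2 * kx) * (ρ₂ * (2 * V t)) = ρ₂ * (1 - σmax) / kx * V t := by
      field_simp
    have h13 : (1 - σmax) / (2 * kx) * (kx * Q + 2 * normL / mθ * X) =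
        (1 - σmax) / 2 * Q + (1 - σmax) * normL / (mθ * kx) * X := by
      field_simp
    have h14 : (1 - σmax) * normL / (mθ * kx) ≤ kd / 2 := by
      rw [div_le_iff₀ (mul_pos hkdpos hmθpos)] at hkxB
      rw [div_le_iff₀ (mul_pos hmθpos hkxpos)]
      linarith
    have h15 := mul_le_mul_of_nonneg_right h14 hXnn
    have h16 := mul_le_mul_of_nonneg_right hk1 hVnn
    have h17 := mul_le_mul_of_nonneg_right hk2 hXnn
    rw [h12, h13] at h11
    rw [hF, ← hX]
    linarith
  refine ⟨hkdpos, fun t ht => ⟨?_, aux_gronwall F _ kF hFd hmain t ht⟩⟩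
  rw [hF]
  have : 0 < ∑ i, χ t i := Finset.sum_pos (fun i _ => hχpos t ht i) Finset.univ_nonempty
  linarith
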